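/- arXiv:1611.04250 — 5 statements merged into one kernel-verified Lean document; each statement's English description precedes it below -/
import Mathlib

section
/- Let N ≥ 1 and let P = (P⁽¹⁾,P⁽²⁾,P⁽³⁾) be a 3-dimensional homogeneous polynomial of degree N with coefficients p_α⁽ʲ⁾ that is divergence-free, i.e. ∂P⁽¹⁾/∂x₁ + ∂P⁽²⁾/∂x₂ + ∂P⁽³⁾/∂x₃ = 0. Then for every ζ ∈ ℂ³ with Re ζ_j > 0 for j = 1,2,3: ∫_𝒦 e^{−x·ζ} (ζ₁P⁽¹⁾(x) + ζ₂P⁽²⁾(x) + ζ₃P⁽³⁾(x)) dx = 𝓘[P](1/ζ₁, 1/ζ₂, 1/ζ₃). -/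
open MeasureTheory MvPolynomial

/-- The multi-index `𝟙 − e_j`, i.e. ones everywhere except at `j` where it is `0`. -/
noncomputable def onesHat (j : Fin 3) : Fin 3 →₀ ℕ :=
  ∑ i ∈ Finset.univ.erase j, Finsupp.single i 1

/-- The homogeneous polynomial `𝓘[P](ρ) = Σ_{j} Σ_{α_j=0} p_α⁽ʲ⁾ · α! · ρ^{α+𝟙−e_j}`
associated with a 3-dimensional (homogeneous) polynomial `P`. -/
noncomputable def calI (P : Fin 3 → MvPolynomial (Fin 3) ℂ) : MvPolynomial (Fin 3) ℂ :=
  ∑ j : Fin 3, ∑ α ∈ (P j).support.filter (fun α => α j = 0),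
    monomial (α + onesHat j) (coeff α (P j) * ∏ i, (Nat.factorial (α i) : ℂ))

theorem norm_exp_neg_mul_mul_pow (n : ℕ) (z : ℂ) {t : ℝ} (ht : 0 ≤ t) :
    ‖Complex.exp (-((t : ℂ) * z)) * (t : ℂ) ^ n‖ = t ^ (n : ℝ) * Real.exp (-z.re * t) := by
  rw [norm_mul, norm_pow, Complex.norm_exp, Complex.norm_of_nonneg ht, Real.rpow_natCast, mul_comm]
  simp [mul_comm]

theorem integrableOn_pow_mul_exp_neg_mul_Ioi (n : ℕ) {z : ℂ} (hz : 0 < z.re) :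
    IntegrableOn (fun t : ℝ => Complex.exp (-((t : ℂ) * z)) * (t : ℂ) ^ n) (Set.Ioi 0) := by
  have h := integrableOn_rpow_mul_exp_neg_mul_rpow (p := 1) (s := n)
    (neg_one_lt_zero.trans_le n.cast_nonneg) one_pos hz
  refine Integrable.mono' h (by fun_prop) ?_
  filter_upwards [ae_restrict_mem measurableSet_Ioi] with t ht
  rw [norm_exp_neg_mul_mul_pow n z (le_of_lt ht), Real.rpow_one]

theorem tendsto_pow_mul_exp_neg_mul_atTop (n : ℕ) {z : ℂ} (hz : 0 < z.re) :
    Filter.Tendsto (fun t : ℝ => Complex.exp (-((t : ℂ) * z)) * (t : ℂ) ^ n) Filter.atTop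
      (nhds 0) := by
  rw [tendsto_zero_iff_norm_tendsto_zero]
  refine (tendsto_rpow_mul_exp_neg_mul_atTop_nhds_zero n z.re hz).congr' ?_
  filter_upwards [Filter.eventually_ge_atTop 0] with t ht
  exact (norm_exp_neg_mul_mul_pow n z ht).symm

theorem hasDerivAt_exp_neg_mul (z : ℂ) (t : ℝ) :
    HasDerivAt (fun t : ℝ => Complex.exp (-((t : ℂ) * z))) (Complex.exp (-((t : ℂ) * z)) * -z) t := by
  simpa using ((Complex.ofRealCLM.hasDerivAt (x := t)).mul_const z).neg.cexp

/-- The Laplace transform of `t ^ n` on the half-line. -/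
theorem integral_pow_mul_exp_neg_mul_Ioi (n : ℕ) {z : ℂ} (hz : 0 < z.re) :
    ∫ t in Set.Ioi (0 : ℝ), Complex.exp (-((t : ℂ) * z)) * (t : ℂ) ^ n
      = (n.factorial : ℂ) * z⁻¹ ^ (n + 1) := by
  have hz0 : z ≠ 0 := by rintro rfl; simp at hz
  induction n with
  | zero =>
    have h := integral_exp_mul_complex_Ioi (a := -z) (by simpa using hz) 0
    simpa [mul_comm] using h
  | succ n ih =>
    have hf_n := (integrableOn_pow_mul_exp_neg_mul_Ioi n hz).const_mul ((n : ℂ) + 1)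
    have hf_succ := (integrableOn_pow_mul_exp_neg_mul_Ioi (n + 1) hz).const_mul z
    have h := integral_Ioi_of_hasDerivAt_of_tendsto'
      (f := fun t : ℝ => Complex.exp (-((t : ℂ) * z)) * (t : ℂ) ^ (n + 1))
      (f' := fun t : ℝ => ((n : ℂ) + 1) * (Complex.exp (-((t : ℂ) * z)) * (t : ℂ) ^ n)
        - z * (Complex.exp (-((t : ℂ) * z)) * (t : ℂ) ^ (n + 1)))
      (fun t _ => by
        convert! (hasDerivAt_exp_neg_mul z t).mul
          ((Complex.ofRealCLM.hasDerivAt (x := t)).pow (n + 1)) using 1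
        simp
        ring)
      (hf_n.sub hf_succ) (tendsto_pow_mul_exp_neg_mul_atTop (n + 1) hz)
    rw [integral_sub hf_n hf_succ, integral_const_mul, integral_const_mul, ih] at h
    simp only [Complex.ofReal_zero, ne_eq, Nat.add_eq_zero_iff, one_ne_zero, and_false,
      not_false_eq_true, zero_pow, mul_zero, sub_zero] at h
    apply mul_left_cancel₀ hz0
    rw [← sub_eq_zero.1 h, Nat.factorial_succ, pow_succ _ (n + 1)]
    push_cast
    field_simp

section Orthant

variable {ι : Type*} [Fintype ι]

theorem volume_restrict_orthant :
    (volume : Measure (ι → ℝ)).restrict {x | ∀ i, 0 < x i}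
      = Measure.pi fun _ => volume.restrict (Set.Ioi 0) := by
  rw [← Measure.restrict_pi_pi, ← volume_pi]
  congr 1
  ext x
  simp

theorem exp_neg_sum_mul_prod_pow (ζ : ι → ℂ) (α : ι → ℕ) (x : ι → ℝ) :
    Complex.exp (-(∑ i, (x i : ℂ) * ζ i)) * ∏ i, (x i : ℂ) ^ α i
      = ∏ i, Complex.exp (-((x i : ℂ) * ζ i)) * (x i : ℂ) ^ α i := by
  rw [Finset.prod_mul_distrib, ← Complex.exp_sum, Finset.sum_neg_distrib]

theorem integrableOn_orthant_exp_mul_prod_pow {ζ : ι → ℂ} (hζ : ∀ i, 0 < (ζ i).re)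
    (α : ι → ℕ) :
    IntegrableOn (fun x : ι → ℝ =>
      Complex.exp (-(∑ i, (x i : ℂ) * ζ i)) * ∏ i, (x i : ℂ) ^ α i) {x | ∀ i, 0 < x i} := by
  rw [IntegrableOn, volume_restrict_orthant]
  simp_rw [exp_neg_sum_mul_prod_pow]
  exact Integrable.fintype_prod
    (f := fun i (t : ℝ) => Complex.exp (-((t : ℂ) * ζ i)) * (t : ℂ) ^ α i)
    fun i => integrableOn_pow_mul_exp_neg_mul_Ioi (α i) (hζ i)

theorem integral_orthant_exp_mul_prod_pow {ζ : ι → ℂ} (hζ : ∀ i, 0 < (ζ i).re)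
    (α : ι → ℕ) :
    ∫ x in {x : ι → ℝ | ∀ i, 0 < x i},
        Complex.exp (-(∑ i, (x i : ℂ) * ζ i)) * ∏ i, (x i : ℂ) ^ α i
      = ∏ i, ((α i).factorial : ℂ) * (ζ i)⁻¹ ^ (α i + 1) := by
  rw [volume_restrict_orthant]
  simp_rw [exp_neg_sum_mul_prod_pow]
  rw [integral_fintype_prod_eq_prod
    (f := fun i (t : ℝ) => Complex.exp (-((t : ℂ) * ζ i)) * (t : ℂ) ^ α i)]
  exact Finset.prod_congr rfl fun i _ => integral_pow_mul_exp_neg_mul_Ioi (α i) (hζ i)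

end Orthant

section Polynomial

variable {σ : Type*} [Fintype σ]

/-- The Laplace transform of a polynomial on the positive orthant, as a function of the
reciprocals `ρ` of the dual variables. -/
noncomputable def polyLaplace (ρ : σ → ℂ) : MvPolynomial σ ℂ →ₗ[ℂ] ℂ :=
  (basisMonomials σ ℂ).constr ℂ fun α => ∏ i, ((α i).factorial : ℂ) * ρ i ^ (α i + 1)

theorem polyLaplace_monomial (ρ : σ → ℂ) (α : σ →₀ ℕ) (c : ℂ) :
    polyLaplace ρ (monomial α c) = c * ∏ i, ((α i).factorial : ℂ) * ρ i ^ (α i + 1) := by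
  have h : monomial α c = c • basisMonomials σ ℂ α := by
    simp [smul_monomial]
  rw [h, map_smul, polyLaplace, Module.Basis.constr_basis, smul_eq_mul]

theorem polyLaplace_eq_sum (ρ : σ → ℂ) (Q : MvPolynomial σ ℂ) :
    polyLaplace ρ Q = ∑ α ∈ Q.support,
      coeff α Q * ∏ i, ((α i).factorial : ℂ) * ρ i ^ (α i + 1) := by
  conv_lhs => rw [Q.as_sum, map_sum]
  simp_rw [polyLaplace_monomial]

theorem exp_neg_mul_eval (ζ : σ → ℂ) (Q : MvPolynomial σ ℂ) (x : σ → ℝ) :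
    Complex.exp (-(∑ i, (x i : ℂ) * ζ i)) * eval (fun i => (x i : ℂ)) Q
      = ∑ α ∈ Q.support, coeff α Q *
          (Complex.exp (-(∑ i, (x i : ℂ) * ζ i)) * ∏ i, (x i : ℂ) ^ α i) := by
  rw [eval_eq', Finset.mul_sum]
  exact Finset.sum_congr rfl fun α _ => mul_left_comm _ _ _

theorem integrableOn_orthant_exp_mul_eval {ζ : σ → ℂ} (hζ : ∀ i, 0 < (ζ i).re)
    (Q : MvPolynomial σ ℂ) :
    IntegrableOn (fun x : σ → ℝ =>
      Complex.exp (-(∑ i, (x i : ℂ) * ζ i)) * eval (fun i => (x i : ℂ)) Q)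
      {x | ∀ i, 0 < x i} := by
  simp_rw [exp_neg_mul_eval]
  exact integrable_finsetSum _ fun α _ =>
    (integrableOn_orthant_exp_mul_prod_pow hζ α).const_mul _

theorem integral_orthant_exp_mul_eval {ζ : σ → ℂ} (hζ : ∀ i, 0 < (ζ i).re)
    (Q : MvPolynomial σ ℂ) :
    ∫ x in {x : σ → ℝ | ∀ i, 0 < x i},
        Complex.exp (-(∑ i, (x i : ℂ) * ζ i)) * eval (fun i => (x i : ℂ)) Q
      = polyLaplace (fun i => (ζ i)⁻¹) Q := by
  simp_rw [exp_neg_mul_eval]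
  rw [integral_finsetSum _ fun (α : σ →₀ ℕ) _ =>
    (integrableOn_orthant_exp_mul_prod_pow hζ α).const_mul (coeff α Q), polyLaplace_eq_sum]
  refine Finset.sum_congr rfl fun α _ => ?_
  rw [integral_const_mul, integral_orthant_exp_mul_prod_pow hζ]

theorem polyLaplace_pderiv_monomial_of_ne_zero {ζ : σ → ℂ} {j : σ} (hζ : ζ j ≠ 0)
    {α : σ →₀ ℕ} (hα : α j ≠ 0) (c : ℂ) :
    polyLaplace (fun i => (ζ i)⁻¹) (pderiv j (monomial α c))
      = ζ j * polyLaplace (fun i => (ζ i)⁻¹) (monomial α c) := by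
  classical
  obtain ⟨β, rfl⟩ : ∃ β, α = β + Finsupp.single j 1 :=
    ⟨α - Finsupp.single j 1,
      (tsub_add_cancel_of_le (Finsupp.single_le_iff.2 (Nat.one_le_iff_ne_zero.2 hα))).symm⟩
  rw [pderiv_monomial, add_tsub_cancel_right, polyLaplace_monomial, polyLaplace_monomial,
    ← Finset.mul_prod_erase _ _ (Finset.mem_univ j),
    ← Finset.mul_prod_erase _ _ (Finset.mem_univ j)]
  have h : ∀ i ∈ Finset.univ.erase j, (β + Finsupp.single j 1 : σ →₀ ℕ) i = β i := fun i hi => by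
    simp [Finsupp.single_eq_of_ne (Finset.ne_of_mem_erase hi)]
  have hprod : ∏ i ∈ Finset.univ.erase j, (((β + Finsupp.single j 1 : σ →₀ ℕ) i).factorial : ℂ)
        * (ζ i)⁻¹ ^ ((β + Finsupp.single j 1 : σ →₀ ℕ) i + 1)
      = ∏ i ∈ Finset.univ.erase j, ((β i).factorial : ℂ) * (ζ i)⁻¹ ^ (β i + 1) :=
    Finset.prod_congr rfl fun i hi => by rw [h i hi]
  rw [hprod]
  simp only [Finsupp.add_apply, Finsupp.single_eq_same, Nat.factorial_succ]
  push_cast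
  rw [pow_succ _ (β j + 1)]
  field_simp

end Polynomial

theorem prod_pow_onesHat (ρ : Fin 3 → ℂ) (j : Fin 3) :
    ρ j * ∏ i, ρ i ^ onesHat j i = ∏ i, ρ i := by
  have h : ∀ i, onesHat j i = if i = j then 0 else 1 := fun i => by
    simp [onesHat, Finsupp.finsetSum_apply, Finsupp.single_apply, ite_not]
  simp_rw [h]
  rw [← Finset.mul_prod_erase _ _ (Finset.mem_univ j),
    ← Finset.mul_prod_erase _ _ (Finset.mem_univ j), if_pos rfl, pow_zero, one_mul]
  congr 1
  refine Finset.prod_congr rfl fun i hi => ?_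
  rw [if_neg (Finset.ne_of_mem_erase hi), pow_one]

theorem mul_polyLaplace (j : Fin 3) {ζ : Fin 3 → ℂ} (hζ : ζ j ≠ 0)
    (Q : MvPolynomial (Fin 3) ℂ) :
    ζ j * polyLaplace (fun i => (ζ i)⁻¹) Q
      = polyLaplace (fun i => (ζ i)⁻¹) (pderiv j Q)
        + eval (fun i => (ζ i)⁻¹) (∑ α ∈ Q.support.filter (fun α => α j = 0),
            monomial (α + onesHat j) (coeff α Q * ∏ i, (Nat.factorial (α i) : ℂ))) := by
  conv_lhs => rw [Q.as_sum]
  conv_rhs => enter [1]; rw [Q.as_sum]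
  simp only [map_sum, Finset.mul_sum]
  rw [Finset.sum_filter, ← Finset.sum_add_distrib]
  refine Finset.sum_congr rfl fun α _ => ?_
  split_ifs with hα
  · rw [pderiv_monomial, hα, Nat.cast_zero, mul_zero, monomial_zero, map_zero, zero_add,
      polyLaplace_monomial, eval_monomial, Finsupp.prod_fintype _ _ fun i => pow_zero _]
    have h := prod_pow_onesHat (fun i => (ζ i)⁻¹) j
    simp only [Finsupp.add_apply, pow_add, pow_one, Finset.prod_mul_distrib]
    rw [← h]
    field_simp
  · rw [add_zero, polyLaplace_pderiv_monomial_of_ne_zero hζ hα]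

/-- if `P` is a divergence-free 3-dimensional homogeneous polynomial of
degree `N ≥ 1`, then for `ζ ∈ ℂ³` with `Re ζ_j > 0`,
`∫_𝒦 e^{−x·ζ} (ζ·P(x)) dx = 𝓘[P](1/ζ₁, 1/ζ₂, 1/ζ₃)`. -/
theorem laplace_transform_divergence_free (N : ℕ) (hN : 1 ≤ N)
    (P : Fin 3 → MvPolynomial (Fin 3) ℂ)
    (hhom : ∀ j, (P j).IsHomogeneous N)
    (hdiv : ∑ j : Fin 3, pderiv j (P j) = 0)
    (ζ : Fin 3 → ℂ) (hζ : ∀ i, 0 < (ζ i).re) :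
    ∫ x in {x : Fin 3 → ℝ | ∀ i, 0 < x i},
        Complex.exp (-(∑ i, (x i : ℂ) * ζ i)) *
          ∑ j : Fin 3, ζ j * eval (fun i => (x i : ℂ)) (P j)
      = eval (fun i => (ζ i)⁻¹) (calI P) := by
  have hζ0 : ∀ j, ζ j ≠ 0 := fun j h => by simpa [h] using hζ j
  simp_rw [Finset.mul_sum, mul_left_comm (Complex.exp _)]
  rw [integral_finsetSum _ fun j _ => (integrableOn_orthant_exp_mul_eval hζ (P j)).const_mul _]
  simp_rw [integral_const_mul, integral_orthant_exp_mul_eval hζ]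
  rw [Finset.sum_congr rfl fun j _ => mul_polyLaplace j (hζ0 j) (P j), Finset.sum_add_distrib,
    ← map_sum, hdiv, map_zero, zero_add, ← map_sum, calI]
end

section
/- Let N ≥ 1 be odd and let P = (P⁽¹⁾,P⁽²⁾,P⁽³⁾) be a 3-dimensional homogeneous polynomial of degree N with coefficients p_α⁽ʲ⁾ such that P is divergence-free (Σ_j ∂P⁽ʲ⁾/∂x_j = 0), curl-free (∂P⁽ʲ⁾/∂x_l = ∂P⁽ˡ⁾/∂x_j for all j,l), and each component P⁽ʲ⁾ is harmonic. Then σ(ρ) divides 𝓘[P](ρ) in ℂ[ρ₁,ρ₂,ρ₃] if and only if p_α⁽ʲ⁾ = 0 for every j ∈ {1,2,3} and every α with |α| = N and α_j = 0; equivalently, if and only if x_j divides P⁽ʲ⁾ for each j = 1,2,3. -/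
open MvPolynomial

/-- `σ(ρ) = ρ₂²ρ₃² + ρ₁²ρ₃² + ρ₁²ρ₂²`. -/
noncomputable def sigma3 : MvPolynomial (Fin 3) ℂ :=
  X 1 ^ 2 * X 2 ^ 2 + X 0 ^ 2 * X 2 ^ 2 + X 0 ^ 2 * X 1 ^ 2

theorem onesHat_apply (j i : Fin 3) : onesHat j i = if i = j then 0 else 1 := by
  fin_cases j <;> fin_cases i <;>
    simp [onesHat, Finsupp.finsetSum_apply, Finsupp.single_apply, Finset.sum_ite_eq',
      Finset.mem_erase]

/-- The coefficients of `𝓘[P]` at monomials involving all three variables vanish. -/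
theorem coeff_calI_eq_zero_of_pos (P : Fin 3 → MvPolynomial (Fin 3) ℂ) (γ : Fin 3 →₀ ℕ)
    (hγ : ∀ i, 0 < γ i) : coeff γ (calI P) = 0 := by
  simp only [calI, coeff_sum, coeff_monomial]
  refine Finset.sum_eq_zero fun j _ => Finset.sum_eq_zero fun α hα => if_neg ?_
  rintro rfl
  have h := hγ j
  simp [onesHat_apply, (Finset.mem_filter.1 hα).2] at h

/-- The coefficient of `𝓘[P]` at `ρ^{α+𝟙−e_j}` is `p_α⁽ʲ⁾ · α!`. -/
theorem coeff_calI_add_onesHat (P : Fin 3 → MvPolynomial (Fin 3) ℂ) (j : Fin 3)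
    (α : Fin 3 →₀ ℕ) (hα : α j = 0) :
    coeff (α + onesHat j) (calI P) = coeff α (P j) * ∏ i, (Nat.factorial (α i) : ℂ) := by
  simp only [calI, coeff_sum, coeff_monomial]
  rw [Finset.sum_eq_single j]
  · simp only [add_left_inj]
    rw [Finset.sum_ite_eq']
    split_ifs with h
    · rfl
    · simp only [Finset.mem_filter, mem_support_iff, hα, and_true, not_not] at h
      simp [h]
  · intro k _ hk
    refine Finset.sum_eq_zero fun β hβ => if_neg fun h => ?_
    have h' := DFunLike.congr_fun h k
    simp [onesHat_apply, (Finset.mem_filter.1 hβ).2, hk] at h'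
  · simp

theorem sigma3_eq_sum_monomial : sigma3 = ∑ j : Fin 3, monomial (2 • onesHat j) (1 : ℂ) := by
  have h (j : Fin 3) : monomial (2 • onesHat j) (1 : ℂ) = ∏ i, X i ^ (2 * onesHat j i) := by
    rw [monomial_eq, C_1, one_mul, Finsupp.prod_fintype _ _ (by simp)]
    simp
  simp only [h, Fin.sum_univ_three, Fin.prod_univ_three, onesHat_apply, sigma3]
  simp

theorem coeff_sigma3_mul (Q : MvPolynomial (Fin 3) ℂ) (γ : Fin 3 →₀ ℕ) :
    coeff γ (sigma3 * Q) =
      ∑ j, if 2 • onesHat j ≤ γ then coeff (γ - 2 • onesHat j) Q else 0 := by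
  simp only [sigma3_eq_sum_monomial, Finset.sum_mul, coeff_sum, coeff_monomial_mul', one_mul]

/-- If `σ Q` has no monomial involving all three variables, then every monomial of `Q` has
even exponents. -/
theorem coeff_eq_zero_of_sigma3_mul {Q : MvPolynomial (Fin 3) ℂ}
    (hQ : ∀ γ : Fin 3 →₀ ℕ, (∀ i, 0 < γ i) → coeff γ (sigma3 * Q) = 0) (i : Fin 3)
    (γ : Fin 3 →₀ ℕ) (hγ : Odd (γ i)) : coeff γ Q = 0 := by
  induction hn : γ i using Nat.strong_induction_on generalizing γ with
  | _ n ih =>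
    have h := hQ (γ + 2 • onesHat i) fun k => by
      by_cases hk : k = i
      · subst hk
        simpa [onesHat_apply] using hγ.pos
      · simp [onesHat_apply, hk]
    rw [coeff_sigma3_mul, Finset.sum_eq_single i] at h
    · simpa using h
    · intro j _ hj
      split_ifs with hle
      · have h2 := hle i
        simp only [Finsupp.smul_apply, Finsupp.add_apply, onesHat_apply, hj.symm, if_true,
          if_false, smul_eq_mul, mul_zero, mul_one, add_zero] at h2
        have h3 : (γ + 2 • onesHat i - 2 • onesHat j) i = γ i - 2 := by
          simp [onesHat_apply, hj.symm]
        refine ih _ ?_ _ ?_ rfl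
        · rw [h3]; omega
        · rw [h3]; exact Nat.Odd.sub_even h2 hγ even_two
      · rfl
    · simp

theorem coeff_sigma3_mul_eq_zero {Q : MvPolynomial (Fin 3) ℂ}
    (hQ : ∀ γ : Fin 3 →₀ ℕ, (∀ i, 0 < γ i) → coeff γ (sigma3 * Q) = 0) (γ : Fin 3 →₀ ℕ)
    (hγ : Odd (∑ i, γ i)) : coeff γ (sigma3 * Q) = 0 := by
  obtain ⟨i, hi⟩ : ∃ i, Odd (γ i) := by
    by_contra! h
    simp only [Nat.not_odd_iff_even] at h
    exact Nat.not_even_iff_odd.2 hγ (Finset.even_sum _ fun i _ => h i)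
  rw [coeff_sigma3_mul]
  refine Finset.sum_eq_zero fun j _ => ?_
  split_ifs with hle
  · refine coeff_eq_zero_of_sigma3_mul hQ i _ ?_
    exact Nat.Odd.sub_even (hle i) hi (by simp)
  · rfl

theorem sum_onesHat (j : Fin 3) : ∑ i, onesHat j i = 2 := by
  fin_cases j <;> simp [onesHat_apply, Fin.sum_univ_three]

theorem calI_eq_zero {P : Fin 3 → MvPolynomial (Fin 3) ℂ}
    (h : ∀ j α, α j = 0 → coeff α (P j) = 0) : calI P = 0 := by
  refine Finset.sum_eq_zero fun j _ => Finset.sum_eq_zero fun α hα => ?_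
  rw [h j α (Finset.mem_filter.1 hα).2, zero_mul, monomial_zero]

theorem sigma3_dvd_calI_iff {N : ℕ} (hodd : Odd N) {P : Fin 3 → MvPolynomial (Fin 3) ℂ}
    (hhom : ∀ j, (P j).IsHomogeneous N) :
    sigma3 ∣ calI P ↔ ∀ j α, α j = 0 → coeff α (P j) = 0 := by
  refine ⟨?_, fun h => calI_eq_zero h ▸ dvd_zero _⟩
  rintro ⟨Q, hQ⟩ j α hα
  by_contra hne
  have hdeg : ∑ i, α i = N := by
    rw [← Finsupp.degree_eq_sum]
    exact not_not.1 fun h => hne ((hhom j).coeff_eq_zero h)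
  refine hne ?_
  have h : coeff (α + onesHat j) (sigma3 * Q) = 0 :=
    coeff_sigma3_mul_eq_zero (fun γ hγ => hQ ▸ coeff_calI_eq_zero_of_pos P γ hγ) _ <| by
      simpa only [Finsupp.add_apply, Finset.sum_add_distrib, sum_onesHat, hdeg]
        using hodd.add_even even_two
  rw [← hQ, coeff_calI_add_onesHat P j α hα, mul_eq_zero] at h
  exact h.resolve_right (Finset.prod_ne_zero_iff.2 fun i _ =>
    Nat.cast_ne_zero.2 (Nat.factorial_ne_zero _))

/-- for odd `N ≥ 1` and `P` a divergence-free, curl-free, componentwise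
harmonic 3-dimensional homogeneous polynomial of degree `N`, `σ ∣ 𝓘[P]` if and only if
`p_α⁽ʲ⁾ = 0` for every `j` and every `α` with `|α| = N`, `α_j = 0`; equivalently, if and
only if `x_j ∣ P⁽ʲ⁾` for each `j`. -/
theorem sigma_dvd_calI_iff_odd (N : ℕ) (hN : 1 ≤ N) (hodd : Odd N)
    (P : Fin 3 → MvPolynomial (Fin 3) ℂ)
    (hhom : ∀ j, (P j).IsHomogeneous N)
    (hdiv : ∑ j : Fin 3, pderiv j (P j) = 0)
    (hcurl : ∀ j l : Fin 3, pderiv l (P j) = pderiv j (P l))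
    (hharm : ∀ j : Fin 3, ∑ l : Fin 3, pderiv l (pderiv l (P j)) = 0) :
    (sigma3 ∣ calI P ↔
      ∀ j : Fin 3, ∀ α : Fin 3 →₀ ℕ, (∑ i : Fin 3, α i) = N → α j = 0 →
        coeff α (P j) = 0) ∧
    (sigma3 ∣ calI P ↔ ∀ j : Fin 3, X j ∣ P j) := by
  have hdvd (j : Fin 3) : X j ∣ P j ↔ ∀ α : Fin 3 →₀ ℕ, α j = 0 → coeff α (P j) = 0 := by
    rw [X_dvd_iff_modMonomial_eq_zero, MvPolynomial.ext_iff]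
    refine forall_congr' fun α => ?_
    by_cases hα : α j = 0
    · simp [hα, coeff_modMonomial_of_not_le]
    · simp [hα, coeff_modMonomial_of_le, Nat.one_le_iff_ne_zero]
  have key := sigma3_dvd_calI_iff hodd hhom
  refine ⟨key.trans ⟨fun h j α _ => h j α, fun h j α hα => ?_⟩, key.trans ?_⟩
  · by_contra hne
    refine hne (h j α ?_ hα)
    rw [← Finsupp.degree_eq_sum]
    exact not_not.1 fun h => hne ((hhom j).coeff_eq_zero h)
  · exact forall_congr' fun j => (hdvd j).symm
end

section
/- Let l ≥ 0 be an integer and C(ρ₁,ρ₂) = Σ_{j=0}^{l} c_j ρ₁^{j} ρ₂^{l−j} a homogeneous polynomial of degree l in two variables with complex coefficients. Suppose (ρ₁² + ρ₂²)·C(ρ₁,ρ₂) = f₁(ρ₁) + f₂(ρ₂) for some single-variable polynomials f₁, f₂. If l is odd then C = 0. If l is even then c_j = 0 for every odd j, c_{2j} = (−1)^{j} c₀ for 0 ≤ j ≤ l/2, and (ρ₁² + ρ₂²)·C(ρ₁,ρ₂) = c₀·(ρ₂^{l+2} + (−1)^{l/2} ρ₁^{l+2}). -/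
open MvPolynomial

/-- The exponent vector of `X 0 ^ a * X 1 ^ b`. -/
noncomputable def exponentPair (a b : ℕ) : Fin 2 →₀ ℕ :=
  Finsupp.single 0 a + Finsupp.single 1 b

lemma exponentPair_def (a b : ℕ) :
    exponentPair a b = Finsupp.single 0 a + Finsupp.single 1 b := rfl

lemma exponentPair_apply_zero (a b : ℕ) : exponentPair a b 0 = a := by
  simp [exponentPair]

lemma exponentPair_apply_one (a b : ℕ) : exponentPair a b 1 = b := by
  simp [exponentPair]

lemma exponentPair_inj {a b a' b' : ℕ} :
    exponentPair a b = exponentPair a' b' ↔ a = a' ∧ b = b' := by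
  refine ⟨fun h => ⟨?_, ?_⟩, fun h => by rw [h.1, h.2]⟩
  · simpa only [exponentPair_apply_zero] using DFunLike.congr_fun h 0
  · simpa only [exponentPair_apply_one] using DFunLike.congr_fun h 1

lemma eq_exponentPair (d : Fin 2 →₀ ℕ) : d = exponentPair (d 0) (d 1) := by
  ext i
  fin_cases i
  · exact (exponentPair_apply_zero _ _).symm
  · exact (exponentPair_apply_one _ _).symm

lemma X_zero_pow_eq_monomial {R : Type*} [CommSemiring R] (n : ℕ) :
    (X 0 : MvPolynomial (Fin 2) R) ^ n = monomial (exponentPair n 0) 1 := by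
  simp [X_pow_eq_monomial, exponentPair]

lemma X_one_pow_eq_monomial {R : Type*} [CommSemiring R] (n : ℕ) :
    (X 1 : MvPolynomial (Fin 2) R) ^ n = monomial (exponentPair 0 n) 1 := by
  simp [X_pow_eq_monomial, exponentPair]

lemma exponentPair_add (a b a' b' : ℕ) :
    exponentPair a b + exponentPair a' b' = exponentPair (a + a') (b + b') := by
  simp only [exponentPair, Finsupp.single_add]
  abel

lemma coeff_aeval_X_zero {R : Type*} [CommSemiring R] (f : Polynomial R) (a b : ℕ) :
    coeff (exponentPair a b) (Polynomial.aeval (X 0 : MvPolynomial (Fin 2) R) f) =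
      if b = 0 then f.coeff a else 0 := by
  classical
  induction f using Polynomial.induction_on' with
  | add p q hp hq =>
    simp only [map_add, coeff_add, hp, hq, Polynomial.coeff_add]
    split_ifs <;> simp
  | monomial n r =>
    rw [Polynomial.aeval_monomial, X_zero_pow_eq_monomial, algebraMap_eq, coeff_C_mul,
      coeff_monomial, Polynomial.coeff_monomial]
    simp only [exponentPair_inj, mul_ite, mul_one, mul_zero]
    grind

lemma coeff_aeval_X_one {R : Type*} [CommSemiring R] (f : Polynomial R) (a b : ℕ) :
    coeff (exponentPair a b) (Polynomial.aeval (X 1 : MvPolynomial (Fin 2) R) f) =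
      if a = 0 then f.coeff b else 0 := by
  classical
  induction f using Polynomial.induction_on' with
  | add p q hp hq =>
    simp only [map_add, coeff_add, hp, hq, Polynomial.coeff_add]
    split_ifs <;> simp
  | monomial n r =>
    rw [Polynomial.aeval_monomial, X_one_pow_eq_monomial, algebraMap_eq, coeff_C_mul,
      coeff_monomial, Polynomial.coeff_monomial]
    simp only [exponentPair_inj, mul_ite, mul_one, mul_zero]
    grind

lemma coeff_sum_sq_mul_homogeneous {R : Type*} [CommSemiring R] (l : ℕ) (c : ℕ → R) (a b : ℕ) :
    coeff (exponentPair a b) ((X 0 ^ 2 + X 1 ^ 2) * ∑ j ∈ Finset.range (l + 1),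
      monomial (Finsupp.single (0 : Fin 2) j + Finsupp.single 1 (l - j)) (c j)) =
      if a + b = l + 2 then (if 2 ≤ a then c (a - 2) else 0) + (if a ≤ l then c a else 0)
      else 0 := by
  classical
  simp only [← exponentPair_def, add_mul, Finset.mul_sum, X_zero_pow_eq_monomial,
    X_one_pow_eq_monomial, monomial_mul, exponentPair_add, coeff_add, coeff_sum, coeff_monomial,
    exponentPair_inj, one_mul, Finset.sum_add_distrib]
  have h₁ : ∀ j ∈ Finset.range (l + 1), (if 2 + j = a ∧ 0 + (l - j) = b then c j else 0) =
      if j = a - 2 then (if a + b = l + 2 ∧ 2 ≤ a then c (a - 2) else 0) else 0 := by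
    intro j hj
    rw [Finset.mem_range] at hj
    grind
  have h₂ : ∀ j ∈ Finset.range (l + 1), (if 0 + j = a ∧ 2 + (l - j) = b then c j else 0) =
      if j = a then (if a + b = l + 2 then c a else 0) else 0 := by
    intro j hj
    rw [Finset.mem_range] at hj
    grind
  rw [Finset.sum_congr rfl h₁, Finset.sum_congr rfl h₂, Finset.sum_ite_eq', Finset.sum_ite_eq']
  simp only [Finset.mem_range, Order.lt_add_one_iff]
  by_cases hab : a + b = l + 2
  · simp [hab, show a - 2 ≤ l by omega]
  · simp [hab]

lemma eq_neg_one_pow_mul_of_add_eq_zero {R : Type*} [Ring R] {c : ℕ → R} {l : ℕ}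
    (h : ∀ i, i + 2 ≤ l → c i + c (i + 2) = 0) (i j : ℕ) (hj : i + 2 * j ≤ l) :
    c (i + 2 * j) = (-1) ^ j * c i := by
  induction j with
  | zero => simp
  | succ j ih =>
    have := h (i + 2 * j) (by omega)
    rw [ih (by omega)] at this
    rw [show i + 2 * (j + 1) = i + 2 * j + 2 by ring, eq_neg_of_add_eq_zero_right this, pow_succ]
    simp

/-- let `C(ρ₁,ρ₂) = Σ_{j=0}^{l} c_j ρ₁^j ρ₂^{l−j}` be homogeneous of
degree `l` and suppose `(ρ₁² + ρ₂²)·C = f₁(ρ₁) + f₂(ρ₂)` for single-variable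
polynomials `f₁, f₂`.  If `l` is odd then `C = 0`; if `l` is even then all
odd-indexed coefficients vanish, `c_{2j} = (−1)^j c₀` for `2j ≤ l`, and
`(ρ₁² + ρ₂²)·C = c₀·(ρ₂^{l+2} + (−1)^{l/2} ρ₁^{l+2})`. -/
theorem two_variable_division_lemma (l : ℕ) (c : ℕ → ℂ)
    (C : MvPolynomial (Fin 2) ℂ)
    (hC : C = ∑ j ∈ Finset.range (l + 1),
      monomial (Finsupp.single 0 j + Finsupp.single 1 (l - j)) (c j))
    (f₁ f₂ : Polynomial ℂ)
    (hf : (X 0 ^ 2 + X 1 ^ 2) * C =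
      Polynomial.aeval (X 0 : MvPolynomial (Fin 2) ℂ) f₁ +
        Polynomial.aeval (X 1 : MvPolynomial (Fin 2) ℂ) f₂) :
    (Odd l → C = 0) ∧
    (Even l →
      (∀ j ≤ l, Odd j → c j = 0) ∧
      (∀ j : ℕ, 2 * j ≤ l → c (2 * j) = (-1 : ℂ) ^ j * c 0) ∧
      (X 0 ^ 2 + X 1 ^ 2) * C =
        MvPolynomial.C (c 0) *
          (X 1 ^ (l + 2) + MvPolynomial.C ((-1 : ℂ) ^ (l / 2)) * X 0 ^ (l + 2))) := by
  classical
  have hcoeff : ∀ a b, 0 < a → 0 < b → a + b = l + 2 →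
      (if 2 ≤ a then c (a - 2) else 0) + (if a ≤ l then c a else 0) = 0 := by
    intro a b ha hb hab
    have h := congrArg (coeff (exponentPair a b)) hf
    rwa [hC, coeff_sum_sq_mul_homogeneous, coeff_add, coeff_aeval_X_zero, coeff_aeval_X_one,
      if_pos hab, if_neg hb.ne', if_neg ha.ne', add_zero] at h
  have hrec : ∀ i, i + 2 ≤ l → c i + c (i + 2) = 0 := by
    intro i hi
    simpa [hi] using hcoeff (i + 2) (l - i) (by omega) (by omega) (by omega)
  have hodd : ∀ j ≤ l, Odd j → c j = 0 := by
    rintro j hj ⟨k, rfl⟩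
    have h1 : c 1 = 0 := by
      simpa [show 1 ≤ l by omega] using hcoeff 1 (l + 1) (by omega) (by omega) (by omega)
    rw [add_comm, eq_neg_one_pow_mul_of_add_eq_zero hrec 1 k (by omega), h1, mul_zero]
  have heven : ∀ j, 2 * j ≤ l → c (2 * j) = (-1 : ℂ) ^ j * c 0 := by
    intro j hj
    simpa using eq_neg_one_pow_mul_of_add_eq_zero hrec 0 j (by omega)
  refine ⟨?_, fun hl => ⟨hodd, heven, ?_⟩⟩
  · rintro ⟨m, rfl⟩
    have hm : c (2 * m) = 0 := by
      simpa using hcoeff (2 * m + 2) 1 (by omega) (by omega) (by omega)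
    have h0 : c 0 = 0 := by simpa [heven m (by omega)] using hm
    rw [hC]
    refine Finset.sum_eq_zero fun j hj => ?_
    rw [Finset.mem_range] at hj
    have hcj : c j = 0 := by
      rcases Nat.even_or_odd' j with ⟨k, rfl | rfl⟩
      · rw [heven k (by omega), h0, mul_zero]
      · exact hodd _ (by omega) ⟨k, rfl⟩
    rw [hcj, monomial_zero]
  · obtain ⟨m, rfl⟩ := hl.exists_two_nsmul
    rw [smul_eq_mul] at *
    have htop := heven m le_rfl
    ext d
    rw [eq_exponentPair d]
    generalize d 0 = a
    generalize d 1 = b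
    rw [hC, coeff_sum_sq_mul_homogeneous, coeff_C_mul, coeff_add, coeff_C_mul,
      X_zero_pow_eq_monomial, X_one_pow_eq_monomial, coeff_monomial, coeff_monomial,
      Nat.mul_div_cancel_left m two_pos]
    simp only [exponentPair_inj]
    by_cases hab : a + b = 2 * m + 2
    · rcases Nat.eq_zero_or_pos a with rfl | ha
      · simp [show b = 2 * m + 2 by omega]
      rcases Nat.eq_zero_or_pos b with rfl | hb
      · simp [show a = 2 * m + 2 by omega, htop, mul_comm (c 0)]
      rw [if_pos hab, hcoeff a b ha hb hab, if_neg (by omega), if_neg (by omega)]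
      simp
    · rw [if_neg hab, if_neg (by omega), if_neg (by omega)]
      simp
end

section
/- Let N ≥ 1 and let P = (P⁽¹⁾,P⁽²⁾,P⁽³⁾) be any 3-dimensional homogeneous polynomial of degree N with coefficients p_α⁽ʲ⁾ (no harmonicity, divergence or curl assumptions). If σ(ρ) divides 𝓘[P](ρ) in ℂ[ρ₁,ρ₂,ρ₃], then p_α⁽ʲ⁾ = 0 for every j ∈ {1,2,3} and every multi-index α with |α| = N such that α_j = 0 and at least one of the two components α_i with i ≠ j is even. -/
open MvPolynomial

theorem coeff_calI (P : Fin 3 → MvPolynomial (Fin 3) ℂ) (β : Fin 3 →₀ ℕ) :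
    coeff β (calI P) = ∑ j : Fin 3, ∑ α ∈ (P j).support.filter (fun α => α j = 0),
      if α + onesHat j = β then coeff α (P j) * ∏ i, (Nat.factorial (α i) : ℂ) else 0 := by
  simp only [calI, coeff_sum, coeff_monomial]

theorem coeff_calI_eq_zero (P : Fin 3 → MvPolynomial (Fin 3) ℂ) {β : Fin 3 →₀ ℕ}
    (hβ : ∀ i, β i ≠ 0) : coeff β (calI P) = 0 := by
  rw [coeff_calI]
  refine Finset.sum_eq_zero fun j _ => Finset.sum_eq_zero fun α hα => if_neg ?_
  rintro rfl
  exact hβ j (by simp [onesHat_apply, (Finset.mem_filter.1 hα).2])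

theorem coeff_add_onesHat_calI (P : Fin 3 → MvPolynomial (Fin 3) ℂ) {j : Fin 3}
    {α : Fin 3 →₀ ℕ} (hα : α j = 0) :
    coeff (α + onesHat j) (calI P) = coeff α (P j) * ∏ i, (Nat.factorial (α i) : ℂ) := by
  rw [coeff_calI, Finset.sum_eq_single j]
  · simp only [add_left_inj, Finset.sum_ite_eq']
    by_cases h : coeff α (P j) = 0 <;> simp [h, hα]
  · refine fun j' _ hj => Finset.sum_eq_zero fun α' hα' => if_neg fun h => ?_
    have := DFunLike.congr_fun h j'
    simp [onesHat_apply, (Finset.mem_filter.1 hα').2, hj] at this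
  · simp

theorem coeff_sigma3_mul_s14 {i j k : Fin 3} (hij : i ≠ j) (hik : i ≠ k) (hjk : j ≠ k)
    (R : MvPolynomial (Fin 3) ℂ) (β : Fin 3 →₀ ℕ) :
    coeff β (sigma3 * R) =
      (if .single j 2 + .single k 2 ≤ β then
        coeff (β - (.single j 2 + .single k 2)) R else 0) +
      (if .single i 2 + .single k 2 ≤ β then
        coeff (β - (.single i 2 + .single k 2)) R else 0) +
      (if .single i 2 + .single j 2 ≤ β then
        coeff (β - (.single i 2 + .single j 2)) R else 0) := by
  have h : sigma3 = monomial (.single j 2 + .single k 2) 1 +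
      monomial (.single i 2 + .single k 2) 1 + monomial (.single i 2 + .single j 2) 1 := by
    have hm (a b : Fin 3) : (monomial (.single a 2 + .single b 2) 1 : MvPolynomial (Fin 3) ℂ) =
        X a ^ 2 * X b ^ 2 := by
      rw [X_pow_eq_monomial, X_pow_eq_monomial, monomial_mul, one_mul]
    simp only [hm, sigma3]
    fin_cases i <;> fin_cases j <;> fin_cases k <;> simp_all <;> ring
  simp only [h, add_mul, coeff_add, coeff_monomial_mul', one_mul]

/-- If the support of `σ * R` avoids the interior of the orthant, then `R` is even in every
variable. -/
theorem even_of_mem_support_of_sigma3_mul {R : MvPolynomial (Fin 3) ℂ}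
    (h : ∀ β : Fin 3 →₀ ℕ, (∀ i, β i ≠ 0) → coeff β (sigma3 * R) = 0)
    (i : Fin 3) {γ : Fin 3 →₀ ℕ} (hγ : γ ∈ R.support) : Even (γ i) := by
  obtain ⟨j, k, hij, hik, hjk, hall⟩ :
      ∃ j k : Fin 3, i ≠ j ∧ i ≠ k ∧ j ≠ k ∧ ∀ l, l = i ∨ l = j ∨ l = k := by
    revert i; decide
  by_contra hodd
  obtain ⟨δ, hδ, hmax⟩ := (R.support.filter fun γ => ¬ Even (γ i)).exists_max_image
    (fun γ => γ j + γ k) ⟨γ, Finset.mem_filter.2 ⟨hγ, hodd⟩⟩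
  rw [Finset.mem_filter] at hδ
  have hvanish (ε : Fin 3 →₀ ℕ) (hε : ¬ Even (ε i)) (hlt : δ j + δ k < ε j + ε k) :
      coeff ε R = 0 := by
    by_contra hne
    have := hmax ε (Finset.mem_filter.2 ⟨mem_support_iff.2 hne, hε⟩)
    omega
  have hcoeff := h (δ + (.single j 2 + .single k 2)) fun l => by
    rcases hall l with rfl | rfl | rfl
    · have : δ l ≠ 0 := fun h0 => hδ.2 (by simp [h0])
      simp [this]
    · simp
    · simp
  have hside {a : Fin 3} (ha : a = j ∨ a = k) :
      (if .single i 2 + .single a 2 ≤ δ + (.single j 2 + .single k 2) then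
        coeff (δ + (.single j 2 + .single k 2) - (.single i 2 + .single a 2)) R else 0) = 0 := by
    split_ifs with hle
    · have hi := hle i
      apply hvanish <;> rcases ha with rfl | rfl <;>
        simp [hij, hik, hjk, hij.symm, hik.symm, hjk.symm] at hi ⊢ <;> grind
    · rfl
  rw [coeff_sigma3_mul_s14 hij hik hjk, hside (.inr rfl), hside (.inl rfl)] at hcoeff
  simp at hcoeff
  exact mem_support_iff.1 hδ.1 hcoeff

/-- for any 3-dimensional homogeneous polynomial `P` of degree `N ≥ 1`
(with no further assumptions), if `σ ∣ 𝓘[P]`, then `p_α⁽ʲ⁾ = 0` for every `j` and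
every `α` with `|α| = N`, `α_j = 0` such that at least one of the components `α_i`,
`i ≠ j`, is even. -/
theorem sigma_dvd_calI_coeff_vanish (N : ℕ) (hN : 1 ≤ N)
    (P : Fin 3 → MvPolynomial (Fin 3) ℂ)
    (hhom : ∀ j, (P j).IsHomogeneous N)
    (hdvd : sigma3 ∣ calI P) :
    ∀ j : Fin 3, ∀ α : Fin 3 →₀ ℕ, (∑ i : Fin 3, α i) = N → α j = 0 →
      (∃ i : Fin 3, i ≠ j ∧ Even (α i)) → coeff α (P j) = 0 := by
  intro j α _ hα ⟨i, hij, hi⟩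
  obtain ⟨R, hR⟩ := hdvd
  have heven (γ) (hγ : ¬ Even (γ i)) : coeff γ R = 0 := by
    by_contra hne
    exact hγ (even_of_mem_support_of_sigma3_mul
      (fun β hβ => hR ▸ coeff_calI_eq_zero P hβ) i (mem_support_iff.2 hne))
  have hodd : ¬ Even ((α + onesHat j) i) := by
    simpa [onesHat_apply, hij, Nat.even_add_one] using hi
  have hsub (μ : Fin 3 →₀ ℕ) (hμ : Even (μ i)) :
      (if μ ≤ α + onesHat j then coeff (α + onesHat j - μ) R else 0) = 0 := by
    split_ifs with hle
    · refine heven _ ?_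
      rw [Finsupp.tsub_apply, Nat.even_sub (hle i)]
      tauto
    · rfl
  have hsingle (a b : Fin 3) : Even ((.single a 2 + .single b 2 : Fin 3 →₀ ℕ) i) := by
    simp only [Finsupp.add_apply, Finsupp.single_apply]
    split_ifs <;> decide
  have hzero := coeff_add_onesHat_calI P hα
  rw [hR, coeff_sigma3_mul_s14 (i := 0) (j := 1) (k := 2) (by decide) (by decide) (by decide),
    hsub _ (hsingle _ _), hsub _ (hsingle _ _), hsub _ (hsingle _ _)] at hzero
  have hfact : ∏ i, (Nat.factorial (α i) : ℂ) ≠ 0 :=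
    Finset.prod_ne_zero_iff.2 fun l _ => Nat.cast_ne_zero.2 (Nat.factorial_ne_zero _)
  simpa [hfact] using hzero.symm
end

section
/- Let N ≥ 1 and let P = (P⁽¹⁾,P⁽²⁾,P⁽³⁾) be a 3-dimensional homogeneous polynomial of degree N that is divergence-free, curl-free and has harmonic components. Assume P is not of the inadmissible form, i.e. it is NOT the case that (N is odd and x_j divides P⁽ʲ⁾ for all j = 1,2,3) and NOT the case that (N is even and ∏_{i≠j} x_i divides P⁽ʲ⁾ for all j = 1,2,3). Then the function ζ ↦ ∫_𝒦 e^{−x·ζ}(ζ₁P⁽¹⁾(x)+ζ₂P⁽²⁾(x)+ζ₃P⁽³⁾(x)) dx does not vanish identically on any nonempty relatively open subset of the set {ζ ∈ ℂ³ : ζ·ζ = 0 and Re ζ_j > 0 for j = 1,2,3}. (Non-vanishing of ζ·ℒ[P](ζ) on the variety ζ·ζ = 0.) -/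
open MeasureTheory MvPolynomial

namespace MvPolynomial

/-- The formal Laplace transform over the positive orthant, sending `x ^ α` to
`∏ i, (α i)! / ζ i ^ (α i + 1)`. -/
noncomputable def laplace {ι : Type*} [Fintype ι] (ζ : ι → ℂ) : MvPolynomial ι ℂ →ₗ[ℂ] ℂ :=
  (basisMonomials ι ℂ).constr ℂ fun α => ∏ i, ((α i).factorial : ℂ) * (ζ i ^ (α i + 1))⁻¹

theorem laplace_monomial {ι : Type*} [Fintype ι] (ζ : ι → ℂ) (α : ι →₀ ℕ) (c : ℂ) :
    laplace ζ (monomial α c) = c * ∏ i, ((α i).factorial : ℂ) * (ζ i ^ (α i + 1))⁻¹ := by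
  have h : monomial α c = c • basisMonomials ι ℂ α := by
    simp [smul_monomial]
  rw [h, map_smul, laplace, Module.Basis.constr_basis, smul_eq_mul]

theorem integrableOn_pow_mul_cexp_neg_mul (n : ℕ) {z : ℂ} (hz : 0 < z.re) :
    IntegrableOn (fun x : ℝ => (x : ℂ) ^ n * Complex.exp (-(x * z))) (Set.Ioi 0) := by
  have h := integrableOn_rpow_mul_exp_neg_mul_rpow (p := 1) (s := n) (b := z.re)
    (by have : (0 : ℝ) ≤ n := n.cast_nonneg
        linarith) one_pos hz
  refine h.mono' (by fun_prop) ?_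
  filter_upwards [ae_restrict_mem measurableSet_Ioi] with x hx
  rw [Set.mem_Ioi] at hx
  simp [Complex.norm_exp, abs_of_pos hx, mul_comm]

theorem integral_pow_mul_cexp_neg_mul (n : ℕ) {z : ℂ} (hz : 0 < z.re) :
    ∫ x : ℝ in Set.Ioi 0, (x : ℂ) ^ n * Complex.exp (-(x * z)) =
      (n.factorial : ℂ) * (z ^ (n + 1))⁻¹ := by
  have hz0 : z ≠ 0 := by rintro rfl; simp at hz
  induction n with
  | zero =>
    have h := integral_exp_mul_complex_Ioi (a := -z) (by simpa using hz) 0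
    simp only [pow_zero, one_mul, Nat.factorial_zero, Nat.cast_one, zero_add, pow_one]
    simpa [mul_comm z] using h
  | succ n ih =>
    have hi := integrableOn_pow_mul_cexp_neg_mul n hz
    have hi' := integrableOn_pow_mul_cexp_neg_mul (n + 1) hz
    have hd (x : ℝ) : HasDerivAt (fun x : ℝ => (x : ℂ) ^ (n + 1) * Complex.exp (-(x * z)))
        ((n + 1) * ((x : ℂ) ^ n * Complex.exp (-(x * z))) -
          z * ((x : ℂ) ^ (n + 1) * Complex.exp (-(x * z)))) x := by
      have h1 : HasDerivAt (fun x : ℝ => (x : ℂ)) 1 x := Complex.ofRealCLM.hasDerivAt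
      refine ((h1.pow (n + 1)).mul (h1.mul_const z).neg.cexp).congr_deriv ?_
      simp
      ring
    have hint_eq := (hi.const_mul ((n : ℂ) + 1)).sub (hi'.const_mul z)
    have hlim := tendsto_zero_of_hasDerivAt_of_integrableOn_Ioi (fun x _ => hd x) hint_eq hi'
    have h := integral_Ioi_of_hasDerivAt_of_tendsto' (fun x _ => hd x) hint_eq hlim
    rw [integral_sub (hi.const_mul _) (hi'.const_mul _), integral_const_mul, integral_const_mul,
      ih] at h
    have h' : z * ∫ x : ℝ in Set.Ioi 0, (x : ℂ) ^ (n + 1) * Complex.exp (-(x * z)) =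
        (n + 1) * ((n.factorial : ℂ) * (z ^ (n + 1))⁻¹) := by
      simp only [Complex.ofReal_zero, ne_eq, Nat.succ_ne_zero, not_false_eq_true, zero_pow,
        zero_mul, sub_zero] at h
      linear_combination -h
    apply mul_left_cancel₀ hz0
    rw [h', Nat.factorial_succ]
    push_cast
    field_simp
    ring

theorem integral_cexp_neg_mul_eval {ι : Type*} [Fintype ι] {ζ : ι → ℂ} (hζ : ∀ i, 0 < (ζ i).re)
    (p : MvPolynomial ι ℂ) :
    IntegrableOn (fun x : ι → ℝ => Complex.exp (-(∑ i, (x i : ℂ) * ζ i)) *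
        eval (fun i => (x i : ℂ)) p) {x | ∀ i, 0 < x i} ∧
      ∫ x in {x : ι → ℝ | ∀ i, 0 < x i}, Complex.exp (-(∑ i, (x i : ℂ) * ζ i)) *
        eval (fun i => (x i : ℂ)) p = laplace ζ p := by
  have hset : {x : ι → ℝ | ∀ i, 0 < x i} = Set.univ.pi fun _ => Set.Ioi 0 := by
    ext; simp
  induction p using MvPolynomial.induction_on' with
  | monomial α c =>
    have e (x : ι → ℝ) : Complex.exp (-(∑ i, (x i : ℂ) * ζ i)) *
        eval (fun i => (x i : ℂ)) (monomial α c) =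
        c * ∏ i, ((x i : ℂ) ^ α i * Complex.exp (-(x i * ζ i))) := by
      rw [eval_monomial, Finset.prod_mul_distrib, ← Complex.exp_sum, Finset.sum_neg_distrib,
        Finsupp.prod_fintype _ _ (by simp)]
      ring
    simp_rw [e, hset, IntegrableOn, volume_pi, Measure.restrict_pi_pi]
    refine ⟨(Integrable.fintype_prod fun i =>
      integrableOn_pow_mul_cexp_neg_mul (α i) (hζ i)).const_mul c, ?_⟩
    rw [integral_const_mul, integral_fintype_prod_eq_prod
      (f := fun i (y : ℝ) => (y : ℂ) ^ α i * Complex.exp (-(y * ζ i))), laplace_monomial]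
    simp_rw [integral_pow_mul_cexp_neg_mul _ (hζ _)]
  | add p q hp hq =>
    simp_rw [map_add, mul_add]
    exact ⟨hp.1.add hq.1, by rw [integral_add hp.1 hq.1, hp.2, hq.2]⟩

theorem laplace_pderiv {ι : Type*} [Fintype ι] [DecidableEq ι] {ζ : ι → ℂ}
    (hζ : ∀ i, ζ i ≠ 0) (p : MvPolynomial ι ℂ) (j : ι) :
    laplace ζ (pderiv j p) = ∑ α ∈ p.support, (if α j = 0 then 0 else ζ j) *
      laplace ζ (monomial α (coeff α p)) := by
  conv_lhs => rw [p.as_sum, map_sum, map_sum]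
  refine Finset.sum_congr rfl fun α _ => ?_
  rw [pderiv_monomial, laplace_monomial, laplace_monomial]
  rcases Nat.eq_zero_or_pos (α j) with h | h
  · simp [h]
  · rw [if_neg h.ne', ← Finset.mul_prod_erase _ _ (Finset.mem_univ j),
      ← Finset.mul_prod_erase _ _ (Finset.mem_univ j)]
    have e : ∏ i ∈ Finset.univ.erase j, (((α - Finsupp.single j 1 : ι →₀ ℕ) i).factorial : ℂ) *
        (ζ i ^ ((α - Finsupp.single j 1 : ι →₀ ℕ) i + 1))⁻¹ =
        ∏ i ∈ Finset.univ.erase j, ((α i).factorial : ℂ) * (ζ i ^ (α i + 1))⁻¹ := by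
      refine Finset.prod_congr rfl fun i hi => ?_
      simp [(Finset.ne_of_mem_erase hi).symm]
    rw [e]
    obtain ⟨m, hm⟩ := Nat.exists_eq_succ_of_ne_zero h.ne'
    have := hζ j
    simp only [Finsupp.coe_tsub, Pi.sub_apply, Finsupp.single_eq_same, hm, Nat.factorial_succ,
      Nat.succ_eq_add_one, Nat.add_sub_cancel]
    push_cast
    field_simp
    ring

theorem laplace_smul {ι : Type*} [Fintype ι] {n : ℕ} {p : MvPolynomial ι ℂ}
    (hp : p.IsHomogeneous n) (c : ℂ) (ζ : ι → ℂ) :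
    laplace (c • ζ) p = (c ^ (n + Fintype.card ι))⁻¹ * laplace ζ p := by
  rw [p.as_sum, map_sum, map_sum, Finset.mul_sum]
  refine Finset.sum_congr rfl fun α hα => ?_
  have hdeg : ∑ i, (α i + 1) = n + Fintype.card ι := by
    have h := hp (mem_support_iff.mp hα)
    change Finsupp.weight (fun _ => 1) α = n at h
    rw [← Finsupp.degree_eq_weight_one, Finsupp.degree_eq_sum] at h
    rw [Finset.sum_add_distrib, h]
    simp
  rw [laplace_monomial, laplace_monomial, ← hdeg, ← Finset.prod_pow_eq_pow_sum]
  simp only [Pi.smul_apply, smul_eq_mul, mul_pow, mul_inv, Finset.prod_mul_distrib,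
    Finset.prod_inv_distrib]
  ring

theorem analyticAt_laplace {ι : Type*} [Fintype ι] (p : MvPolynomial ι ℂ) {ζ : ι → ℂ}
    (hζ : ∀ i, ζ i ≠ 0) : AnalyticAt ℂ (fun z : ι → ℂ => laplace z p) ζ := by
  have h (z : ι → ℂ) : laplace z p = ∑ α ∈ p.support, coeff α p *
      ∏ i, ((α i).factorial : ℂ) * (z i ^ (α i + 1))⁻¹ := by
    conv_lhs => rw [p.as_sum, map_sum]
    simp_rw [laplace_monomial]
  simp_rw [h]
  refine Finset.analyticAt_fun_sum _ fun α _ => analyticAt_const.mul ?_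
  refine Finset.analyticAt_fun_prod _ fun i _ => analyticAt_const.mul ?_
  refine AnalyticAt.fun_inv (AnalyticAt.fun_pow ?_ _) (pow_ne_zero _ (hζ i))
  exact (ContinuousLinearMap.proj (R := ℂ) (φ := fun _ : ι => ℂ) i).analyticAt ζ

/-- On the isotropic cone, a homogeneous function that is analytic off the coordinate planes and
vanishes near one point vanishes everywhere off the coordinate planes. -/
theorem eq_zero_of_eventually_eq_zero_isotropic {f : (Fin 3 → ℂ) → ℂ}
    (hf : ∀ ζ, (∀ i, ζ i ≠ 0) → AnalyticAt ℂ f ζ)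
    (hsmul : ∀ c : ℂ, c ≠ 0 → ∀ ζ, f ζ = 0 → f (c • ζ) = 0)
    {ζ₀ : Fin 3 → ℂ} (h₀ : ∑ i, ζ₀ i ^ 2 = 0) (hne₀ : ∀ i, ζ₀ i ≠ 0)
    (hev : ∀ᶠ ζ in nhds ζ₀, ∑ i, ζ i ^ 2 = 0 → f ζ = 0)
    {ζ : Fin 3 → ℂ} (hζ : ∑ i, ζ i ^ 2 = 0) (hne : ∀ i, ζ i ≠ 0) : f ζ = 0 := by
  let γ : ℂ → Fin 3 → ℂ := fun t => ![t, (1 - t ^ 2) / 2, Complex.I * (1 + t ^ 2) / 2]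
  have hγ (t : ℂ) : ∑ i, γ t i ^ 2 = 0 := by
    simp only [γ, Fin.sum_univ_three, Matrix.cons_val]
    linear_combination (1 + t ^ 2) ^ 2 / 4 * Complex.I_sq
  have hpar (z : Fin 3 → ℂ) (hz : ∑ i, z i ^ 2 = 0) (hz0 : ∀ i, z i ≠ 0) :
      ∃ q t : ℂ, q ≠ 0 ∧ z = q • γ t := by
    rw [Fin.sum_univ_three] at hz
    have hq : z 1 - Complex.I * z 2 ≠ 0 := by
      intro hq
      apply pow_ne_zero 2 (hz0 0)
      linear_combination hz - (z 1 + Complex.I * z 2) * hq - z 2 ^ 2 * Complex.I_sq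
    obtain ⟨q, hqz⟩ : ∃ q, q = z 1 - Complex.I * z 2 := ⟨_, rfl⟩
    rw [← hqz] at hq
    have hz' : z 0 ^ 2 + q ^ 2 + 2 * Complex.I * q * z 2 = 0 := by
      rw [hqz]
      linear_combination hz - z 2 ^ 2 * Complex.I_sq
    refine ⟨q, z 0 / q, hq, ?_⟩
    ext i
    fin_cases i
    · simp [γ]
      field_simp
    · simp [γ]
      field_simp
      linear_combination hz' - 2 * q * hqz
    · simp [γ]
      field_simp
      linear_combination (-Complex.I) * hz' + 2 * q * z 2 * Complex.I_sq
  have hcurve : AnalyticOnNhd ℂ γ Set.univ := by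
    intro t _
    rw [analyticAt_pi_iff]
    intro i
    fin_cases i
    · exact analyticAt_id
    · exact (by fun_prop : AnalyticAt ℂ (fun t : ℂ => (1 - t ^ 2) / 2) t)
    · exact (by fun_prop : AnalyticAt ℂ (fun t : ℂ => Complex.I * (1 + t ^ 2) / 2) t)
  obtain ⟨q₀, t₀, hq₀, rfl⟩ := hpar ζ₀ h₀ hne₀
  obtain ⟨q, t, hq, rfl⟩ := hpar ζ hζ hne
  let B : Set ℂ := {0, 1, -1, Complex.I, -Complex.I}
  have hB (s : ℂ) : s ∈ Bᶜ ↔ ∀ i, γ s i ≠ 0 := by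
    have h1 : 1 - s ^ 2 = 0 ↔ s = 1 ∨ s = -1 := by
      rw [← sq_eq_sq_iff_eq_or_eq_neg, sub_eq_zero, one_pow, eq_comm]
    have h2 : 1 + s ^ 2 = 0 ↔ s = Complex.I ∨ s = -Complex.I := by
      rw [← sq_eq_sq_iff_eq_or_eq_neg, Complex.I_sq, add_eq_zero_iff_eq_neg', eq_comm]
    simp only [Fin.forall_fin_succ, γ, B]
    simp [h1, h2]
    tauto
  have hmem (c : ℂ) (s : ℂ) (h : ∀ i, (c • γ s) i ≠ 0) : s ∈ Bᶜ :=
    (hB s).mpr fun i hi => h i (by simp [hi])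
  have hpre : IsPreconnected Bᶜ :=
    (Set.Countable.isPathConnected_compl_of_one_lt_rank (by simp)
      (Set.toFinite B).countable).isConnected.isPreconnected
  have han : AnalyticOnNhd ℂ (fun s => f (q₀ • γ s)) Bᶜ := by
    intro s hs
    refine AnalyticAt.fun_comp (g := f) (f := fun s => q₀ • γ s) (hf _ fun i => ?_) ?_
    · simpa [hq₀] using (hB s).mp hs i
    · exact AnalyticAt.const_smul (f := γ) (c := q₀) (hcurve s trivial)
  have hcont : ContinuousAt (fun s => q₀ • γ s) t₀ :=
    ((hcurve t₀ trivial).const_smul (c := q₀)).continuousAt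
  have hzero := han.eqOn_zero_of_preconnected_of_eventuallyEq_zero hpre (hmem _ _ hne₀) (by
    filter_upwards [hcont.eventually hev] with s hs
    refine hs ?_
    simp only [Pi.smul_apply, smul_eq_mul, mul_pow, ← Finset.mul_sum, hγ, mul_zero])
  have h := hsmul (q / q₀) (div_ne_zero hq hq₀) _ (hzero (hmem _ _ hne))
  rwa [smul_smul, div_mul_cancel₀ _ hq₀] at h

theorem sum_ite_sq_mul_laplace_monomial {ζ : Fin 3 → ℂ} (hζ : ∑ i, ζ i ^ 2 = 0)
    (hne : ∀ i, ζ i ≠ 0) {u : MvPolynomial (Fin 3) ℂ}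
    (h : ∑ j, ζ j * laplace ζ (pderiv j u) = 0) :
    ∑ α ∈ u.support, (∑ j, if α j = 0 then ζ j ^ 2 else 0) *
      laplace ζ (monomial α (coeff α u)) = 0 := by
  simp_rw [laplace_pderiv hne, Finset.mul_sum] at h
  rw [Finset.sum_comm] at h
  rw [← neg_eq_zero, ← Finset.sum_neg_distrib]
  refine Eq.trans ?_ h
  refine Finset.sum_congr rfl fun α _ => ?_
  simp_rw [← mul_assoc, ← Finset.sum_mul, ← neg_mul]
  congr 1
  rw [neg_eq_iff_add_eq_zero, ← Finset.sum_add_distrib]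
  refine Eq.trans ?_ hζ
  refine Finset.sum_congr rfl fun j _ => ?_
  split_ifs <;> ring

theorem _root_.Polynomial.eq_zero_of_tendsto_eval_zero {q : Polynomial ℂ}
    (h : Filter.Tendsto (fun x : ℝ => q.eval (x : ℂ)) Filter.atTop (nhds 0)) : q = 0 := by
  by_cases hd : 0 < q.degree
  · have hx : Filter.Tendsto (fun x : ℝ => ‖(x : ℂ)‖) Filter.atTop Filter.atTop := by
      simpa using Filter.tendsto_abs_atTop_atTop (G := ℝ)
    exact absurd h.norm (not_tendsto_nhds_of_tendsto_atTop (q.tendsto_norm_atTop hd hx) _)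
  · rw [Polynomial.eq_C_of_degree_le_zero (not_lt.mp hd)] at h ⊢
    simp only [Polynomial.eval_C] at h
    rw [tendsto_nhds_unique h tendsto_const_nhds |>.symm, map_zero]

theorem coeff_eq_zero_of_sum_laplace_pderiv_eq_zero {n : ℕ} {u : MvPolynomial (Fin 3) ℂ}
    (hu : u.IsHomogeneous n)
    (hF : ∀ ζ : Fin 3 → ℂ, ∑ i, ζ i ^ 2 = 0 → (∀ i, ζ i ≠ 0) →
      ∑ j, ζ j * laplace ζ (pderiv j u) = 0)
    {j k l : Fin 3} (hjk : j ≠ k) (hjl : j ≠ l) (hkl : k ≠ l) {α : Fin 3 →₀ ℕ}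
    (hl : α l = 0) (hj : Odd (α j)) : coeff α u = 0 := by
  have huniv : (Finset.univ : Finset (Fin 3)) = {j, k, l} := by
    clear hl hj
    revert j k l; decide
  have hsum (f : Fin 3 → ℂ) : ∑ i, f i = f j + f k + f l := by
    rw [huniv, Finset.sum_insert (by simp [hjk, hjl]), Finset.sum_pair hkl, add_assoc]
  have hprod (f : Fin 3 → ℂ) : ∏ i, f i = f j * (f k * f l) := by
    rw [huniv, Finset.prod_insert (by simp [hjk, hjl]), Finset.prod_pair hkl]
  have hdeg {β : Fin 3 →₀ ℕ} (hβ : β ∈ u.support) : β j + β k + β l = n := by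
    have h := hu (mem_support_iff.mp hβ)
    change Finsupp.weight (fun _ => 1) β = n at h
    rw [← Finsupp.degree_eq_weight_one, Finsupp.degree_eq_sum, huniv,
      Finset.sum_insert (by simp [hjk, hjl]), Finset.sum_pair hkl] at h
    omega
  by_contra hα
  rw [← ne_eq, ← mem_support_iff] at hα
  let D (β : Fin 3 →₀ ℕ) : ℂ := coeff β u * ((β j).factorial * ((β k).factorial * (β l).factorial))
  let z (y : ℝ) : ℂ := Complex.I * (√(1 + y ^ 2) : ℝ)
  have hz0 (y : ℝ) : z y ≠ 0 := by
    have : 0 < √(1 + y ^ 2) := by positivity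
    simp [z, this.ne']
  have hz2 (y : ℝ) : z y ^ 2 = -(1 + (y : ℂ) ^ 2) := by
    rw [mul_pow, Complex.I_sq, ← Complex.ofReal_pow, Real.sq_sqrt (by positivity)]
    push_cast
    ring
  have hzc : Continuous z := by fun_prop
  let q : Polynomial ℂ := ∑ β ∈ u.support.filter (fun β => Odd (β j) ∧ β l = 0),
    Polynomial.monomial (β k + 1) (D β)
  let r (y : ℝ) : ℂ := ∑ β ∈ u.support.filter (fun β => Odd (β j) ∧ β k = 0),
    D β * (z y ^ (β l + 1))⁻¹
  have key (y : ℝ) (hy : 0 < y) : q.eval ((y⁻¹ : ℝ) : ℂ) = -(z y)⁻¹ * y * r y := by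
    have hy0 : (y : ℂ) ≠ 0 := by exact_mod_cast hy.ne'
    let p (s : ℂ) : Fin 3 → ℂ := fun i => if i = j then s else if i = k then (y : ℂ) else z y
    have hpj (s : ℂ) : p s j = s := by simp [p]
    have hpk (s : ℂ) : p s k = y := by simp [p, hjk.symm]
    have hpl (s : ℂ) : p s l = z y := by simp [p, hjl.symm, hkl.symm]
    have hp (s : ℂ) (hs : s ^ 2 = 1) :
        ∑ β ∈ u.support, ((if β j = 0 then s ^ 2 else 0) + (if β k = 0 then (y : ℂ) ^ 2 else 0) +
          (if β l = 0 then z y ^ 2 else 0)) *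
          (D β * ((s ^ (β j + 1))⁻¹ * (((y : ℂ) ^ (β k + 1))⁻¹ * (z y ^ (β l + 1))⁻¹))) = 0 := by
      have hs0 : s ≠ 0 := by rintro rfl; simp at hs
      have hcone : ∑ i, p s i ^ 2 = 0 := by
        rw [hsum, hpj, hpk, hpl, hs, hz2]
        ring
      have hne (i : Fin 3) : p s i ≠ 0 := by
        simp only [p]
        split_ifs
        exacts [hs0, hy0, hz0 y]
      refine Eq.trans ?_ (sum_ite_sq_mul_laplace_monomial hcone hne (hF _ hcone hne))
      refine Finset.sum_congr rfl fun β _ => ?_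
      rw [laplace_monomial, hsum, hprod, hpj, hpk, hpl]
      simp only [D]
      ring
    have h2 : ∑ β ∈ u.support,
        (z y * (if Odd (β j) ∧ β l = 0 then D β * ((y⁻¹ : ℝ) : ℂ) ^ (β k + 1) else 0) +
          y * (if Odd (β j) ∧ β k = 0 then D β * (z y ^ (β l + 1))⁻¹ else 0)) = 0 := by
      have h1 := congrArg₂ (· + ·) (hp 1 (by norm_num)) (hp (-1) (by norm_num))
      simp only [add_zero] at h1
      rw [← Finset.sum_add_distrib] at h1
      apply mul_left_cancel₀ (two_ne_zero (α := ℂ))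
      rw [mul_zero, Finset.mul_sum]
      refine Eq.trans ?_ h1
      refine Finset.sum_congr rfl fun β _ => ?_
      have hzy := hz0 y
      rcases Nat.even_or_odd (β j) with hb | hb
      · simp only [Nat.not_odd_iff_even.mpr hb, false_and, if_false, hb.add_one.neg_one_pow]
        simp
      · have hbj : β j ≠ 0 := by rintro h; simp [h] at hb
        simp only [hb, hbj, true_and, if_false, hb.add_one.neg_one_pow, one_pow]
        split_ifs with h1 h2 h2
        · simp only [h1, h2]
          push_cast
          field_simp
          ring
        · simp only [h1, Complex.ofReal_inv, inv_pow]
          field_simp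
          ring
        · simp only [h2]
          push_cast
          field_simp
          ring
        · ring
    rw [Finset.sum_add_distrib, ← Finset.mul_sum, ← Finset.mul_sum, ← Finset.sum_filter,
      ← Finset.sum_filter] at h2
    have hq : q.eval ((y⁻¹ : ℝ) : ℂ) = ∑ β ∈ u.support.filter (fun β => Odd (β j) ∧ β l = 0),
        D β * ((y⁻¹ : ℝ) : ℂ) ^ (β k + 1) := by
      simp [q, Polynomial.eval_finsetSum]
    rw [← hq] at h2
    apply mul_left_cancel₀ (hz0 y)
    have := mul_inv_cancel₀ (hz0 y)
    linear_combination h2 + y * r y * this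
  have hlim : Filter.Tendsto (fun x : ℝ => q.eval (x : ℂ)) Filter.atTop (nhds 0) := by
    have hc : Continuous fun y : ℝ => -(z y)⁻¹ * y * r y := by
      have hr : Continuous r := continuous_finsetSum _ fun β _ =>
        continuous_const.mul ((hzc.pow _).inv₀ fun y => pow_ne_zero _ (hz0 y))
      exact ((hzc.inv₀ hz0).neg.mul Complex.continuous_ofReal).mul hr
    have h0 := (hc.tendsto 0).comp tendsto_inv_atTop_zero
    simp only [Complex.ofReal_zero, mul_zero, zero_mul] at h0
    refine h0.congr' ?_
    filter_upwards [Filter.eventually_gt_atTop 0] with x hx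
    rw [Function.comp_apply, ← key x⁻¹ (inv_pos.mpr hx), inv_inv]
  have hq0 := congrArg (Polynomial.coeff · (α k + 1)) (Polynomial.eq_zero_of_tendsto_eval_zero hlim)
  simp only [q, Polynomial.finsetSum_coeff, Polynomial.coeff_zero, Polynomial.coeff_monomial] at hq0
  rw [Finset.sum_eq_single_of_mem α (by simp [hj, hl, mem_support_iff.mp hα])] at hq0
  · simp only [if_true, D, mul_eq_zero, Nat.cast_eq_zero, Nat.factorial_ne_zero, or_false] at hq0
    exact mem_support_iff.mp hα hq0
  · intro β hβ hβα
    rw [Finset.mem_filter] at hβ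
    refine if_neg fun hk => hβα ?_
    have h1 := hdeg hα
    have h2 := hdeg hβ.1
    ext i
    have hi : i = j ∨ i = k ∨ i = l := by
      have := Finset.mem_univ i
      rw [huniv] at this
      simpa using this
    rcases hi with rfl | rfl | rfl <;> omega

theorem IsHomogeneous.exists_pderiv_eq {ι R : Type*} [Fintype ι] [DecidableEq ι] [Field R]
    [CharZero R] {n : ℕ} {P : ι → MvPolynomial ι R} (hP : ∀ j, (P j).IsHomogeneous n)
    (hcurl : ∀ j l, pderiv l (P j) = pderiv j (P l)) :
    ∃ u : MvPolynomial ι R, u.IsHomogeneous (n + 1) ∧ ∀ l, pderiv l u = P l := by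
  refine ⟨C ((n : R) + 1)⁻¹ * ∑ j, X j * P j, ?_, fun l => ?_⟩
  · rw [← zero_add (n + 1)]
    refine (isHomogeneous_C _ _).mul (IsHomogeneous.sum _ _ _ fun j _ => ?_)
    rw [add_comm n 1]
    exact (isHomogeneous_X _ j).mul (hP j)
  · have hE := (hP l).sum_X_mul_pderiv
    have hl : pderiv l (∑ j, X j * P j) = P l + n • P l := by
      rw [← hE, map_sum]
      simp_rw [Derivation.leibniz, hcurl _ l, pderiv_X, smul_eq_mul]
      rw [Finset.sum_add_distrib, add_comm]
      congr 1
      simp [Pi.single_apply]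
    have hn : (n : R) + 1 ≠ 0 := by exact_mod_cast n.succ_ne_zero
    rw [Derivation.leibniz, hl, pderiv_C, smul_zero, add_zero, smul_eq_mul, nsmul_eq_mul,
      ← one_add_mul, ← mul_assoc, ← map_natCast (C : R →+* MvPolynomial ι R),
      ← map_one (C : R →+* MvPolynomial ι R), ← map_add, ← map_mul,
      add_comm (1 : R), inv_mul_cancel₀ hn, map_one, one_mul]

theorem dvd_of_forall_coeff_eq_zero {ι R : Type*} [DecidableEq ι] [CommRing R]
    {p : MvPolynomial ι R} {s : Finset ι} (h : ∀ β : ι →₀ ℕ, ∀ i ∈ s, β i = 0 → coeff β p = 0) :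
    ∏ i ∈ s, X i ∣ p := by
  have hs : ∏ i ∈ s, X i = monomial (∑ i ∈ s, Finsupp.single i 1) (1 : R) := by
    rw [monomial_sum_one]
    rfl
  rw [p.as_sum, hs]
  refine Finset.dvd_sum fun β hβ => monomial_dvd_monomial.mpr ⟨Or.inr fun i => ?_, one_dvd _⟩
  rw [Finsupp.finsetSum_apply]
  simp_rw [Finsupp.single_apply]
  rw [Finset.sum_ite_eq' s i]
  split_ifs with hi
  · exact Nat.one_le_iff_ne_zero.mpr fun h0 => mem_support_iff.mp hβ (h β i hi h0)
  · exact Nat.zero_le _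

theorem coeff_eq_zero_of_odd_of_sum_pderiv_pderiv_eq_zero {n : ℕ} {u : MvPolynomial (Fin 3) ℂ}
    (hu : u.IsHomogeneous n) (hn : Even n) (hharm : ∑ j, pderiv j (pderiv j u) = 0)
    (hface : ∀ (α : Fin 3 →₀ ℕ) (j l : Fin 3), Odd (α j) → α l = 0 → coeff α u = 0)
    (α : Fin 3 →₀ ℕ) (j : Fin 3) (hj : Odd (α j)) : coeff α u = 0 := by
  by_cases hα : coeff α u = 0
  · exact hα
  have hdeg : α 0 + α 1 + α 2 = n := by
    have h := hu hα
    change Finsupp.weight (fun _ => 1) α = n at h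
    rwa [← Finsupp.degree_eq_weight_one, Finsupp.degree_eq_sum, Fin.sum_univ_three] at h
  obtain ⟨m, hm⟩ : ∃ m, Even (α m) := by
    by_contra! h
    simp_rw [Nat.not_even_iff_odd] at h
    have := hdeg ▸ ((h 0).add_odd (h 1)).add_odd (h 2)
    exact Nat.not_even_iff_odd.mpr this hn
  clear hdeg hα
  obtain ⟨a, ha⟩ := hm.exists_two_nsmul
  induction a generalizing α with
  | zero => exact hface α j m hj (by simpa using ha)
  | succ a ih =>
    have hmj : m ≠ j := by
      rintro rfl
      exact Nat.not_even_iff_odd.mpr hj hm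
    let β : Fin 3 →₀ ℕ := α - Finsupp.single m 2
    have hβ : β + Finsupp.single m 1 + Finsupp.single m 1 = α := by
      rw [add_assoc, ← Finsupp.single_add]
      exact tsub_add_cancel_of_le (Finsupp.single_le_iff.mpr (by simp at ha; omega))
    have hβm : β m = 2 * a := by simp [β, ha]; omega
    have hβj : Odd (β j) := by simpa [β, hmj] using hj
    have h := congrArg (coeff β) hharm
    rw [coeff_sum, coeff_zero, Finset.sum_eq_single m] at h
    · rw [coeff_pderiv, coeff_pderiv, hβ, mul_assoc] at h
      exact (mul_eq_zero.mp h).resolve_right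
        (mul_ne_zero (Nat.cast_add_one_ne_zero _) (Nat.cast_add_one_ne_zero _))
    · intro i _ hi
      have hm' : (β + Finsupp.single i 1 + Finsupp.single i 1 : Fin 3 →₀ ℕ) m = 2 * a := by
        simp [hi, hβm]
      rw [coeff_pderiv, coeff_pderiv, ih, zero_mul, zero_mul]
      · rw [add_assoc, ← Finsupp.single_add, Finsupp.add_apply]
        refine hβj.add_even ?_
        rw [Finsupp.single_apply]
        split_ifs <;> decide
      · rw [hm']
        exact even_two_mul a
      · rw [hm', smul_eq_mul]
    · simp

end MvPolynomial

/-- let `P` be a divergence-free, curl-free, componentwise harmonic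
3-dimensional homogeneous polynomial of degree `N ≥ 1` which is not of the inadmissible
form (neither: `N` odd and `x_j ∣ P⁽ʲ⁾` for all `j`; nor: `N` even and
`∏_{i≠j} x_i ∣ P⁽ʲ⁾` for all `j`).  Then `ζ ↦ ∫_𝒦 e^{−x·ζ} (ζ·P(x)) dx` does not vanish
identically on any nonempty relatively open subset of
`{ζ ∈ ℂ³ : ζ·ζ = 0, Re ζ_j > 0 ∀j}`. -/
theorem laplace_transform_nonvanishing (N : ℕ) (hN : 1 ≤ N)
    (P : Fin 3 → MvPolynomial (Fin 3) ℂ)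
    (hhom : ∀ j, (P j).IsHomogeneous N)
    (hdiv : ∑ j : Fin 3, pderiv j (P j) = 0)
    (hcurl : ∀ j l : Fin 3, pderiv l (P j) = pderiv j (P l))
    (hharm : ∀ j : Fin 3, ∑ l : Fin 3, pderiv l (pderiv l (P j)) = 0)
    (hadm : ¬ ((Odd N ∧ ∀ j : Fin 3, X j ∣ P j) ∨
        (Even N ∧ ∀ j : Fin 3, (∏ i ∈ Finset.univ.erase j, X i) ∣ P j))) :
    ∀ S : Set (Fin 3 → ℂ), S.Nonempty →
      (∃ U : Set (Fin 3 → ℂ), IsOpen U ∧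
        S = U ∩ {ζ : Fin 3 → ℂ | (∑ i, ζ i ^ 2 = 0) ∧ ∀ i, 0 < (ζ i).re}) →
      ∃ ζ ∈ S,
        (∫ x in {x : Fin 3 → ℝ | ∀ i, 0 < x i},
            Complex.exp (-(∑ i, (x i : ℂ) * ζ i)) *
              ∑ j : Fin 3, ζ j * eval (fun i => (x i : ℂ)) (P j)) ≠ 0 := by
  rintro S ⟨ζ₀, hζ₀⟩ ⟨U, hU, rfl⟩
  obtain ⟨hζ₀U, h₀, hre₀⟩ := hζ₀
  by_contra! hzero
  have hne_of_re {z : ℂ} (hz : 0 < z.re) : z ≠ 0 := by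
    rintro rfl
    simp at hz
  obtain ⟨u, hu, hPu⟩ := IsHomogeneous.exists_pderiv_eq hhom hcurl
  have hint_eq {ζ : Fin 3 → ℂ} (hζ : ∀ i, 0 < (ζ i).re) :
      ∫ x in {x : Fin 3 → ℝ | ∀ i, 0 < x i}, Complex.exp (-(∑ i, (x i : ℂ) * ζ i)) *
        ∑ j : Fin 3, ζ j * eval (fun i => (x i : ℂ)) (P j) = ∑ j, ζ j * laplace ζ (P j) := by
    simp_rw [Finset.mul_sum, mul_left_comm _ (ζ _)]
    rw [integral_finsetSum _ fun j _ => (integral_cexp_neg_mul_eval hζ (P j)).1.const_mul (ζ j)]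
    simp_rw [integral_const_mul, (integral_cexp_neg_mul_eval hζ _).2]
  have hev : ∀ᶠ ζ in nhds ζ₀, ∑ i, ζ i ^ 2 = 0 → ∑ j, ζ j * laplace ζ (P j) = 0 := by
    have hre : ∀ᶠ ζ : Fin 3 → ℂ in nhds ζ₀, ∀ i, 0 < (ζ i).re :=
      Filter.eventually_all.mpr fun i =>
        (Complex.continuous_re.comp (continuous_apply i)).continuousAt.eventually_const_lt (hre₀ i)
    filter_upwards [hU.mem_nhds hζ₀U, hre] with ζ hζU hζ h
    rw [← hint_eq hζ]
    exact hzero ζ ⟨hζU, h, hζ⟩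
  have hF (ζ : Fin 3 → ℂ) (hζ : ∑ i, ζ i ^ 2 = 0) (hne : ∀ i, ζ i ≠ 0) :
      ∑ j, ζ j * laplace ζ (pderiv j u) = 0 := by
    simp_rw [hPu]
    refine eq_zero_of_eventually_eq_zero_isotropic (f := fun ζ => ∑ j, ζ j * laplace ζ (P j))
      (fun z hz => ?_) (fun c _ z hz => ?_) h₀ (fun i => hne_of_re (hre₀ i)) hev hζ hne
    · refine Finset.analyticAt_fun_sum _ fun j _ => AnalyticAt.fun_mul ?_ (analyticAt_laplace _ hz)
      exact (ContinuousLinearMap.proj (R := ℂ) (φ := fun _ : Fin 3 => ℂ) j).analyticAt z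
    · have e : ∑ j, (c • z) j * laplace (c • z) (P j) =
          c * (c ^ (N + Fintype.card (Fin 3)))⁻¹ * ∑ j, z j * laplace z (P j) := by
        rw [Finset.mul_sum]
        refine Finset.sum_congr rfl fun j _ => ?_
        rw [laplace_smul (hhom j), Pi.smul_apply, smul_eq_mul]
        ring
      simp only [e, hz, mul_zero]
  have hface (α : Fin 3 →₀ ℕ) (j l : Fin 3) (hj : Odd (α j)) (hl : α l = 0) : coeff α u = 0 := by
    have hjl : j ≠ l := by
      rintro rfl
      simp [hl] at hj
    obtain ⟨k, hjk, hkl⟩ : ∃ k, j ≠ k ∧ k ≠ l := by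
      clear hj hl
      revert j l
      decide
    exact coeff_eq_zero_of_sum_laplace_pderiv_eq_zero hu hF hjk hjl hkl hl hj
  have hcoeff (β : Fin 3 →₀ ℕ) (j : Fin 3) (h : coeff (β + Finsupp.single j 1) u = 0) :
      coeff β (P j) = 0 := by
    rw [← hPu, coeff_pderiv, h, zero_mul]
  refine hadm (N.even_or_odd.symm.imp (fun hodd => ⟨hodd, fun j => ?_⟩)
    fun heven => ⟨heven, fun j => ?_⟩)
  · rw [← Finset.prod_singleton (fun i => (X i : MvPolynomial (Fin 3) ℂ)) j]
    refine dvd_of_forall_coeff_eq_zero fun β i hi h => hcoeff β j ?_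
    obtain rfl := Finset.mem_singleton.mp hi
    refine coeff_eq_zero_of_odd_of_sum_pderiv_pderiv_eq_zero hu hodd.add_one ?_ hface _ i ?_
    · simpa only [hPu] using hdiv
    · simp [h]
  · refine dvd_of_forall_coeff_eq_zero fun β i hi h => hcoeff β j ?_
    by_contra hc
    refine hc ?_
    have hi0 : (β + Finsupp.single j 1 : Fin 3 →₀ ℕ) i = 0 := by
      simp [h, Finset.ne_of_mem_erase hi]
    obtain ⟨m, hm⟩ : ∃ m, Odd ((β + Finsupp.single j 1 : Fin 3 →₀ ℕ) m) := by
      by_contra! hall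
      simp_rw [Nat.not_odd_iff_even] at hall
      have hdeg := hu hc
      change Finsupp.weight (fun _ => 1) _ = N + 1 at hdeg
      rw [← Finsupp.degree_eq_weight_one, Finsupp.degree_eq_sum] at hdeg
      exact Nat.not_even_iff_odd.mpr heven.add_one (hdeg ▸ Finset.even_sum _ fun i _ => hall i)
    exact hface _ m i hm hi0
end
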